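/- Let q be a prime power, g ≥ 2, s ≥ 3, V = GF(q^g)^s regarded as a GF(q)-vector space of dimension gs, and let 𝒢 be the Desarguesian (g-1)-spread of V. For every k with 3 ≤ k ≤ s−1, the triple (V, 𝒢, ℱ_k), where ℱ_k is the set of all fat k-dimensional GF(q)-subspaces of V, is a (gs, g, k, λ)_q-GDD with λ = q^{(g-1)(binom(k,2)−1)} · ∏_{i=2}^{k-1} (q^{g(s-i)} − 1)/(q^{k-i} − 1). -/

import Mathlib

def gaussBinom (q n m : ℕ) : ℕ :=
  (∏ i ∈ Finset.range m, (q ^ (n - i) - 1)) / ∏ i ∈ Finset.range m, (q ^ (m - i) - 1)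

def IsSpread (F : Type*) {V : Type*} [Field F] [AddCommGroup V] [Module F V]
    (g : ℕ) (𝒢 : Set (Submodule F V)) : Prop :=
  (∀ S ∈ 𝒢, Module.finrank F S = g) ∧
    ∀ P : Submodule F V, Module.finrank F P = 1 → ∃! S, S ∈ 𝒢 ∧ P ≤ S

def IsScattered (F : Type*) {V : Type*} [Field F] [AddCommGroup V] [Module F V]
    (𝒢 : Set (Submodule F V)) (B : Submodule F V) : Prop :=
  ∀ S ∈ 𝒢, Module.finrank F ↥(B ⊓ S) ≤ 1

def IsGDD (F : Type*) {V : Type*} [Field F] [AddCommGroup V] [Module F V]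
    (g k lam : ℕ) (𝒢 ℬ : Set (Submodule F V)) : Prop :=
  IsSpread F g 𝒢 ∧ 1 < 𝒢.ncard ∧ (∀ B ∈ ℬ, Module.finrank F B = k) ∧
    ∀ L : Submodule F V, Module.finrank F L = 2 →
      ((∃ S ∈ 𝒢, L ≤ S) → (∃! S, S ∈ 𝒢 ∧ L ≤ S) ∧ ∀ B ∈ ℬ, ¬ L ≤ B) ∧
      ((¬ ∃ S ∈ 𝒢, L ≤ S) → {B ∈ ℬ | L ≤ B}.ncard = lam)

def IsSubspaceDesign (F : Type*) {V : Type*} [Field F] [AddCommGroup V] [Module F V]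
    (k lam : ℕ) (ℬ : Set (Submodule F V)) : Prop :=
  (∀ B ∈ ℬ, Module.finrank F B = k) ∧
    ∀ L : Submodule F V, Module.finrank F L = 2 → {B ∈ ℬ | L ≤ B}.ncard = lam

def IsFat (F : Type*) {E : Type*} [Field F] [Field E] [Algebra F E] {s : ℕ}
    (U : Submodule F (Fin s → E)) : Prop :=
  Module.finrank E (Submodule.span E (U : Set (Fin s → E))) = Module.finrank F U

def DesargSpread (F : Type*) (E : Type*) [Field F] [Field E] [Algebra F E] (s : ℕ) :
    Set (Submodule F (Fin s → E)) :=
  {S | ∃ W : Submodule E (Fin s → E), Module.finrank E W = 1 ∧ S = W.restrictScalars F}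

def slMap (F : Type*) {E : Type*} [Field F] [Field E] [Algebra F E] {s : ℕ}
    (A : Matrix.SpecialLinearGroup (Fin s) E) (U : Submodule F (Fin s → E)) :
    Submodule F (Fin s → E) :=
  U.map (LinearMap.restrictScalars F (Matrix.toLin' (A : Matrix (Fin s) (Fin s) E)))

section Fat

variable {F E : Type*} [Field F] [Field E] [Algebra F E] {s : ℕ}

theorem finrank_span_le_finrank [Finite E] (U : Submodule F (Fin s → E)) :
    Module.finrank E (Submodule.span E (U : Set (Fin s → E))) ≤ Module.finrank F U := by
  have b := Module.finBasis F U
  have hU : Submodule.span F (Set.range fun i => (b i : Fin s → E)) = U := by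
    have h := congrArg (Submodule.map U.subtype) b.span_eq
    rwa [Submodule.map_span, ← Set.range_comp, Submodule.map_top, Submodule.range_subtype] at h
  have h := finrank_range_le_card (R := E) fun i => (b i : Fin s → E)
  rw [Set.finrank, ← Submodule.span_span_of_tower F, hU] at h
  simpa using h

theorem span_coe_sup (U W : Submodule F (Fin s → E)) :
    Submodule.span E ((U ⊔ W : Submodule F (Fin s → E)) : Set (Fin s → E)) =
      Submodule.span E (U : Set (Fin s → E)) ⊔ Submodule.span E (W : Set (Fin s → E)) := by
  rw [← Submodule.span_union, ← Submodule.span_span_of_tower F E (_ ∪ _), Submodule.span_union,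
    Submodule.span_eq, Submodule.span_eq]

theorem IsFat.mono [Finite E] {L U : Submodule F (Fin s → E)} (hU : IsFat F U) (hLU : L ≤ U) :
    IsFat F L := by
  obtain ⟨C, hdisj, hsup⟩ := IsModularLattice.exists_disjoint_and_sup_eq hLU
  have hdim := Submodule.finrank_sup_add_finrank_inf_eq L C
  have hspan := Submodule.finrank_add_le_finrank_add_finrank
    (Submodule.span E (L : Set (Fin s → E))) (Submodule.span E (C : Set (Fin s → E)))
  rw [hdisj.eq_bot, finrank_bot, hsup] at hdim
  rw [← span_coe_sup, hsup, hU] at hspan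
  have hL := finrank_span_le_finrank L
  have hC := finrank_span_le_finrank C
  unfold IsFat
  omega

theorem span_coe_sup_span_singleton (L : Submodule F (Fin s → E)) (v : Fin s → E) :
    Submodule.span E ((L ⊔ Submodule.span F {v} : Submodule F (Fin s → E)) : Set (Fin s → E)) =
      Submodule.span E (L : Set (Fin s → E)) ⊔ Submodule.span E {v} := by
  rw [span_coe_sup, Submodule.span_span_of_tower]

theorem IsFat.sup_span_singleton [Finite E] {L : Submodule F (Fin s → E)} (hL : IsFat F L)
    {v : Fin s → E} (hv : v ∉ Submodule.span E (L : Set (Fin s → E))) :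
    IsFat F (L ⊔ Submodule.span F {v}) := by
  have hvL : v ∉ L := fun h => hv (Submodule.subset_span h)
  rw [IsFat, span_coe_sup_span_singleton, Submodule.finrank_sup_span_singleton hv,
    Submodule.finrank_sup_span_singleton hvL, hL]

theorem IsFat.mem_span_iff [Finite E] {L U : Submodule F (Fin s → E)} (hU : IsFat F U)
    (hLU : L ≤ U) {v : Fin s → E} (hv : v ∈ U) :
    v ∈ Submodule.span E (L : Set (Fin s → E)) ↔ v ∈ L := by
  refine ⟨fun h => ?_, fun h => Submodule.subset_span h⟩
  by_contra hvL
  have hfat : IsFat F (L ⊔ Submodule.span F {v}) :=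
    hU.mono (sup_le hLU ((Submodule.span_singleton_le_iff_mem _ _).2 hv))
  have hL := hU.mono hLU
  rw [IsFat, span_coe_sup_span_singleton, Submodule.finrank_sup_span_singleton hvL,
    sup_eq_left.2 ((Submodule.span_singleton_le_iff_mem _ _).2 h), hL] at hfat
  omega

theorem card_filter_mem_and_notMem {R V : Type*} [Field R] [Fintype R] [AddCommGroup V]
    [Module R V] [Fintype V] [DecidableEq V] {L U : Submodule R V} (hLU : L ≤ U)
    [DecidablePred (· ∈ L)] [DecidablePred (· ∈ U)] :
    (Finset.univ.filter fun v => v ∈ U ∧ v ∉ L).card =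
      Fintype.card R ^ Module.finrank R U - Fintype.card R ^ Module.finrank R L := by
  have hcard (W : Submodule R V) [DecidablePred (· ∈ W)] :
      (Finset.univ.filter (· ∈ W)).card = Fintype.card R ^ Module.finrank R W := by
    rw [← Module.card_eq_pow_finrank (K := R) (V := W), Fintype.card_subtype]
  rw [← hcard, ← hcard, ← Finset.card_sdiff_of_subset]
  · congr 1
    ext v
    simp
  · intro v hv
    simp only [Finset.mem_filter, Finset.mem_univ, true_and] at hv ⊢
    exact hLU hv

open Classical in
theorem card_fat_mul_prod [Fintype F] [Fintype E] {k : ℕ} (d : ℕ) :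
    ∀ (j : ℕ), j + d = k → ∀ L : Submodule F (Fin s → E), IsFat F L → Module.finrank F L = j →
      (Finset.univ.filter fun U : Submodule F (Fin s → E) =>
          (IsFat F U ∧ Module.finrank F U = k) ∧ L ≤ U).card *
        ∏ i ∈ Finset.Ico j k, (Fintype.card F ^ k - Fintype.card F ^ i) =
      ∏ i ∈ Finset.Ico j k, (Fintype.card E ^ s - Fintype.card E ^ i) := by
  induction d with
  | zero =>
    rintro j rfl L hL hLj
    have h : (Finset.univ.filter fun U : Submodule F (Fin s → E) =>
        (IsFat F U ∧ Module.finrank F U = j + 0) ∧ L ≤ U) = {L} := by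
      ext U
      simp only [Finset.mem_filter, Finset.mem_univ, true_and, Finset.mem_singleton]
      constructor
      · rintro ⟨⟨-, hU⟩, hLU⟩
        exact (Submodule.eq_of_le_of_finrank_eq hLU (by omega)).symm
      · rintro rfl
        exact ⟨⟨hL, by omega⟩, le_rfl⟩
    rw [h]
    simp
  | succ d ih =>
    intro j hj L hL hLj
    have hjk : j < k := by omega
    rw [Finset.prod_eq_prod_Ico_succ_bot hjk, Finset.prod_eq_prod_Ico_succ_bot hjk, ← mul_assoc]
    set S := Finset.univ.filter fun U : Submodule F (Fin s → E) =>
      (IsFat F U ∧ Module.finrank F U = k) ∧ L ≤ U with hS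
    set T := Finset.univ.filter fun v : Fin s → E =>
      v ∉ Submodule.span E (L : Set (Fin s → E)) with hT
    have hTcard : T.card = Fintype.card E ^ s - Fintype.card E ^ j := by
      have h := card_filter_mem_and_notMem
        (le_top : Submodule.span E (L : Set (Fin s → E)) ≤ ⊤)
      rw [hL, hLj, finrank_top, Module.finrank_fin_fun] at h
      simpa [hT] using h
    have hAbove : ∀ U ∈ S, (T.bipartiteAbove (fun U v => v ∈ U) U).card =
        Fintype.card F ^ k - Fintype.card F ^ j := by
      intro U hU
      obtain ⟨⟨hfat, hUk⟩, hLU⟩ := (Finset.mem_filter.1 hU).2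
      rw [← hUk, ← hLj, ← card_filter_mem_and_notMem hLU]
      congr 1
      ext v
      simp only [Finset.mem_bipartiteAbove, hT, Finset.mem_filter, Finset.mem_univ, true_and]
      constructor
      · rintro ⟨h1, h2⟩
        exact ⟨h2, fun h => h1 ((hfat.mem_span_iff hLU h2).2 h)⟩
      · rintro ⟨h1, h2⟩
        exact ⟨fun h => h2 ((hfat.mem_span_iff hLU h1).1 h), h1⟩
    have hcount := Finset.sum_card_bipartiteAbove_eq_sum_card_bipartiteBelow
      (s := S) (t := T) (fun U v => v ∈ U)
    rw [Finset.sum_congr rfl hAbove, Finset.sum_const, smul_eq_mul] at hcount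
    rw [hcount, Finset.sum_mul, ← hTcard, ← smul_eq_mul, ← Finset.sum_const]
    refine Finset.sum_congr rfl fun v hv => ?_
    have hv' := (Finset.mem_filter.1 hv).2
    rw [← ih (j + 1) (by omega) (L ⊔ Submodule.span F {v}) (hL.sup_span_singleton hv')
      (by rw [Submodule.finrank_sup_span_singleton fun h => hv' (Submodule.subset_span h), hLj])]
    congr 2
    ext U
    simp only [Finset.mem_bipartiteBelow, hS, Finset.mem_filter, Finset.mem_univ, true_and,
      sup_le_iff, Submodule.span_singleton_le_iff_mem, and_assoc]

end Fat

theorem prod_pow_sub_pow (q n a k : ℕ) (hkn : k ≤ n) :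
    ∏ i ∈ Finset.Ico a k, (q ^ n - q ^ i) =
      q ^ (∑ i ∈ Finset.Ico a k, i) * ∏ i ∈ Finset.Ico a k, (q ^ (n - i) - 1) := by
  rw [← Finset.prod_pow_eq_pow_sum, ← Finset.prod_mul_distrib]
  refine Finset.prod_congr rfl fun i hi => ?_
  have hi' := (Finset.mem_Ico.1 hi).2
  rw [Nat.mul_sub, mul_one, ← pow_add, Nat.add_sub_cancel' (by omega)]

theorem sum_Ico_two_id {k : ℕ} (hk : 2 ≤ k) : ∑ i ∈ Finset.Ico 2 k, i = k.choose 2 - 1 := by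
  have h := Finset.sum_range_add_sum_Ico (fun i => i) hk
  rw [Finset.sum_range_id k, ← Nat.choose_two_right, Finset.sum_range_id 2] at h
  omega

theorem eq_pow_mul_div {N q m g A D : ℕ} (hg : 1 ≤ g) (hq : 0 < q) (hD : 0 < D)
    (hcop : D.Coprime q) (h : N * (q ^ m * D) = (q ^ g) ^ m * A) :
    N = q ^ ((g - 1) * m) * (A / D) := by
  obtain ⟨g, rfl⟩ := Nat.exists_eq_add_of_le' hg
  have h' : N * D = q ^ (g * m) * A := by
    refine Nat.eq_of_mul_eq_mul_left (pow_pos hq m) ?_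
    rw [← pow_mul, add_mul, one_mul, pow_add] at h
    linarith
  have hdvd : D ∣ A := (hcop.pow_right (g * m)).dvd_of_dvd_mul_left ⟨N, by rw [← h', mul_comm]⟩
  rw [Nat.add_sub_cancel, ← Nat.mul_div_assoc _ hdvd, ← h', Nat.mul_div_cancel _ hD]

section Spread

variable {F E : Type*} [Field F] [Field E] [Algebra F E] {s : ℕ}

theorem span_eq_of_le_restrictScalars [Finite E] {L : Submodule F (Fin s → E)}
    {W : Submodule E (Fin s → E)} (hL : L ≠ ⊥) (hW : Module.finrank E W = 1)
    (hLW : L ≤ W.restrictScalars F) : W = Submodule.span E (L : Set (Fin s → E)) := by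
  have hle : Submodule.span E (L : Set (Fin s → E)) ≤ W := Submodule.span_le.2 hLW
  refine (Submodule.eq_of_le_of_finrank_le hle ?_).symm
  rw [hW, Nat.one_le_iff_ne_zero, Ne, Submodule.finrank_eq_zero, Submodule.span_eq_bot]
  exact fun h => hL ((Submodule.eq_bot_iff L).2 h)

theorem existsUnique_mem_desargSpread [Finite E] {L : Submodule F (Fin s → E)} (hL : L ≠ ⊥)
    (h : ∃ S ∈ DesargSpread F E s, L ≤ S) : ∃! S, S ∈ DesargSpread F E s ∧ L ≤ S := by
  obtain ⟨S, ⟨W, hW, rfl⟩, hLW⟩ := h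
  refine ⟨_, ⟨⟨W, hW, rfl⟩, hLW⟩, ?_⟩
  rintro _ ⟨⟨W', hW', rfl⟩, hLW'⟩
  rw [span_eq_of_le_restrictScalars hL hW hLW, span_eq_of_le_restrictScalars hL hW' hLW']

theorem exists_mem_desargSpread [Finite E] {L : Submodule F (Fin s → E)}
    (hL : L ≠ ⊥) (h : Module.finrank E (Submodule.span E (L : Set (Fin s → E))) ≤ 1) :
    ∃ S ∈ DesargSpread F E s, L ≤ S := by
  refine ⟨_, ⟨_, le_antisymm h ?_, rfl⟩, fun _ hx => Submodule.subset_span hx⟩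
  rw [Nat.one_le_iff_ne_zero, Ne, Submodule.finrank_eq_zero, Submodule.span_eq_bot]
  exact fun h => hL ((Submodule.eq_bot_iff L).2 h)

theorem isSpread_desargSpread [Finite E] :
    IsSpread F (Module.finrank F E) (DesargSpread F E s) := by
  constructor
  · rintro _ ⟨W, hW, rfl⟩
    have h := Module.finrank_mul_finrank F E W
    rw [hW, mul_one] at h
    exact h.symm
  · intro P hP
    have hP0 : P ≠ ⊥ := by
      rintro rfl
      simp at hP
    exact existsUnique_mem_desargSpread hP0
      (exists_mem_desargSpread hP0 (hP ▸ finrank_span_le_finrank P))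

theorem one_lt_ncard_desargSpread [Finite E] (hs : 2 ≤ s) : 1 < (DesargSpread F E s).ncard := by
  have hmem (i : Fin s) : (Submodule.span E {(Pi.single i 1 : Fin s → E)}).restrictScalars F ∈
      DesargSpread F E s := ⟨_, finrank_span_singleton (by simp), rfl⟩
  rw [Set.one_lt_ncard (Set.toFinite _)]
  refine ⟨_, hmem ⟨0, by omega⟩, _, hmem ⟨1, by omega⟩, fun h => ?_⟩
  have h0 : (Pi.single ⟨0, by omega⟩ 1 : Fin s → E) ∈
      Submodule.span E {(Pi.single ⟨1, by omega⟩ 1 : Fin s → E)} := by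
    rw [← Submodule.restrictScalars_mem F, ← h]
    exact Submodule.mem_span_singleton_self _
  obtain ⟨c, hc⟩ := Submodule.mem_span_singleton.1 h0
  simpa [Pi.single_apply, Fin.ext_iff] using congrFun hc ⟨0, by omega⟩

end Spread

theorem stmt_14 (F E : Type) [Field F] [Fintype F] [Field E] [Fintype E] [Algebra F E]
    (g s k : ℕ) (hg : 2 ≤ g) (hs : 3 ≤ s) (hFE : Module.finrank F E = g)
    (hk3 : 3 ≤ k) (hks : k ≤ s - 1) :
    IsGDD F g k
      ((Fintype.card F) ^ ((g - 1) * (Nat.choose k 2 - 1)) *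
        ((∏ i ∈ Finset.Ico 2 k, ((Fintype.card F) ^ (g * (s - i)) - 1)) /
          ∏ i ∈ Finset.Ico 2 k, ((Fintype.card F) ^ (k - i) - 1)))
      (DesargSpread F E s)
      {U : Submodule F (Fin s → E) | IsFat F U ∧ Module.finrank F U = k} := by
  classical
  refine ⟨hFE ▸ isSpread_desargSpread, one_lt_ncard_desargSpread (by omega), fun B hB => hB.2,
    fun L hL => ?_⟩
  have hL0 : L ≠ ⊥ := by
    rintro rfl
    simp at hL
  refine ⟨fun h => ⟨existsUnique_mem_desargSpread hL0 h, ?_⟩, fun h => ?_⟩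
  · rintro B ⟨hB, -⟩ hLB
    obtain ⟨_, ⟨W, hW, rfl⟩, hLW⟩ := h
    have hfat := hB.mono hLB
    rw [IsFat, ← span_eq_of_le_restrictScalars hL0 hW hLW, hW, hL] at hfat
    omega
  · have hfat : IsFat F L := by
      have hle := finrank_span_le_finrank L
      have hlt := mt (exists_mem_desargSpread hL0) h
      unfold IsFat
      omega
    have hq : 1 < Fintype.card F := Fintype.one_lt_card
    have hcount := card_fat_mul_prod (k := k) (k - 2) 2 (by omega) L hfat hL
    rw [prod_pow_sub_pow _ _ _ _ le_rfl, prod_pow_sub_pow _ _ _ _ (by omega : k ≤ s),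
      sum_Ico_two_id (by omega), Module.card_eq_pow_finrank (K := F) (V := E), hFE] at hcount
    simp only [← pow_mul _ g (s - _)] at hcount
    have hset : {B ∈ {U : Submodule F (Fin s → E) | IsFat F U ∧ Module.finrank F U = k} | L ≤ B} =
        ((Finset.univ.filter fun U : Submodule F (Fin s → E) =>
          (IsFat F U ∧ Module.finrank F U = k) ∧ L ≤ U : Finset _) : Set _) := by
      ext U
      simp
    rw [hset, Set.ncard_coe_finset]
    refine eq_pow_mul_div (by omega) (by omega) ?_ ?_ hcount
    · refine Finset.prod_pos fun i hi => Nat.sub_pos_of_lt (Nat.one_lt_pow ?_ hq)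
      have := (Finset.mem_Ico.1 hi).2
      omega
    · refine Nat.Coprime.prod_left fun i hi => ?_
      have hi' := (Finset.mem_Ico.1 hi).2
      have hpos : 0 < Fintype.card F ^ (k - i) := pow_pos (by omega) _
      refine Nat.Coprime.coprime_dvd_right (dvd_pow_self _ (by omega : k - i ≠ 0)) ?_
      rw [Nat.coprime_comm]
      exact (Nat.coprime_self_sub_right hpos).2 (Nat.coprime_one_right _)
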